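/- arXiv:0910.3588 — 2 statements merged into one kernel-verified Lean document; each statement's English description precedes it below -/
import Mathlib

section
/- There exist universal constants (one may take 2 and 1/8) such that the following holds. Let φ : ℝ^d → (0,∞) and χ : ℝ^d → ℝ be differentiable at a point x ∈ ℝ^d, with |∇φ(x)| ≤ φ(x). Then: (i) |∇(φ^{1/2}χ)(x)|² ≤ 2 φ(x) ( |∇χ(x)|² + |χ(x)|² ), and (ii) |∇(φ^{1/2}χ)(x)|² + φ(x)|χ(x)|² ≥ (1/8) φ(x) ( |∇χ(x)|² + |χ(x)|² ). In particular, the map χ ↦ φ^{1/2}χ transforms the weighted W^{1,2}-quantity φ(|∇χ|² + |χ|²) into the unweighted one, up to universal multiplicative constants. -/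
open Real

noncomputable section

/-- Pointwise equivalence of weighted and unweighted `W^{1,2}`-quantities under the
transformation `χ ↦ φ^{1/2} χ`, for weights satisfying `|∇φ| ≤ φ`. -/
theorem statement12 (d : ℕ) (hd : 1 ≤ d)
    (φ χ : EuclideanSpace ℝ (Fin d) → ℝ) (x : EuclideanSpace ℝ (Fin d))
    (hφp : ∀ y, 0 < φ y)
    (hφ : DifferentiableAt ℝ φ x) (hχ : DifferentiableAt ℝ χ x)
    (hgrad : ‖gradient φ x‖ ≤ φ x) :
    ‖gradient (fun y => Real.sqrt (φ y) * χ y) x‖ ^ 2 ≤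
        2 * φ x * (‖gradient χ x‖ ^ 2 + χ x ^ 2) ∧
      (1 / 8) * φ x * (‖gradient χ x‖ ^ 2 + χ x ^ 2) ≤
        ‖gradient (fun y => Real.sqrt (φ y) * χ y) x‖ ^ 2 + φ x * χ x ^ 2 := by
  have hpos := hφp x
  have hs : 0 < Real.sqrt (φ x) := Real.sqrt_pos.mpr hpos
  have hsq : Real.sqrt (φ x) ^ 2 = φ x := Real.sq_sqrt hpos.le
  have key : ∀ f : EuclideanSpace ℝ (Fin d) → ℝ, ‖gradient f x‖ = ‖fderiv ℝ f x‖ := by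
    intro f
    simp [gradient]
  rw [key] at hgrad
  rw [key, key]
  have hD := ((hφ.hasFDerivAt.sqrt hpos.ne').mul hχ.hasFDerivAt).fderiv
  change fderiv ℝ (fun y => Real.sqrt (φ y) * χ y) x = _ at hD
  rw [hD]
  generalize fderiv ℝ φ x = A at *
  generalize fderiv ℝ χ x = B at *
  set s := Real.sqrt (φ x) with hsdef
  rw [← hsq] at hgrad ⊢
  set w := χ x • (1 / (2 * s)) • A with hw
  have hwn : ‖w‖ ≤ s * (|χ x| / 2) := by
    rw [hw, norm_smul, norm_smul, Real.norm_eq_abs, Real.norm_eq_abs,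
      abs_of_pos (by positivity : 0 < 1 / (2 * s))]
    calc |χ x| * (1 / (2 * s) * ‖A‖) ≤ |χ x| * (1 / (2 * s) * s ^ 2) := by gcongr
      _ = s * (|χ x| / 2) := by field_simp
  have hB : ‖s • B‖ = s * ‖B‖ := by
    rw [norm_smul, Real.norm_eq_abs, abs_of_pos hs]
  have h1 : ‖s • B + w‖ ≤ s * ‖B‖ + s * (|χ x| / 2) := by
    have := norm_add_le (s • B) w
    linarith
  have h2 : s * ‖B‖ ≤ ‖s • B + w‖ + s * (|χ x| / 2) := by
    have := norm_sub_le (s • B + w) w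
    rw [add_sub_cancel_right] at this
    linarith
  rw [← sq_abs (χ x)]
  have h0 := norm_nonneg (s • B + w)
  have hb := norm_nonneg B
  have hc := abs_nonneg (χ x)
  have h1' := pow_le_pow_left₀ h0 h1 2
  have h2' := pow_le_pow_left₀ (by positivity) h2 2
  generalize ‖s • B + w‖ = D at *
  generalize ‖B‖ = b at *
  generalize |χ x| = c at *
  constructor
  · nlinarith [sq_nonneg (s * b - s * (c / 2)), sq_nonneg (s * c)]
  · nlinarith [sq_nonneg (D - s * (c / 2)), sq_nonneg (s * c), sq_nonneg D]
end
end

section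
/- Let d ∈ ℕ, d ≥ 1, let c₀, c₁, R > 0 and ε₀ ∈ (0,1]. Let H : (0, ε₀] → ℝ be antitone (i.e. H(ε') ≤ H(ε) whenever ε ≤ ε' ≤ ε₀) with H(ε₀) ≤ 0, and assume the recurrence H(α/2) ≤ H(α) + c₀ (R + c₁ ln(1/α))^d for all α ∈ (0, ε₀]. Then for every ε ∈ (0, ε₀] one has H(ε) ≤ c₀ (1 + log₂(ε₀/ε)) (R + c₁ ln(2/ε))^d. -/
open Real

/-- The abstract iteration lemma underlying the Kolmogorov ε-entropy bound: an antitone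
quantity `H` satisfying the one-step recurrent estimate
`H(α/2) ≤ H(α) + c₀ (R + c₁ ln(1/α))^d` with `H(ε₀) ≤ 0` satisfies
`H(ε) ≤ c₀ (1 + log₂(ε₀/ε)) (R + c₁ ln(2/ε))^d`. -/
theorem statement13 (d : ℕ) (hd : 1 ≤ d) (c₀ c₁ R : ℝ) (hc₀ : 0 < c₀) (hc₁ : 0 < c₁)
    (hR : 0 < R) (ε₀ : ℝ) (hε₀ : 0 < ε₀) (hε₀le : ε₀ ≤ 1)
    (H : ℝ → ℝ)
    (hmono : ∀ ε ε' : ℝ, 0 < ε → ε ≤ ε' → ε' ≤ ε₀ → H ε' ≤ H ε)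
    (hinit : H ε₀ ≤ 0)
    (hrec : ∀ α : ℝ, 0 < α → α ≤ ε₀ →
      H (α / 2) ≤ H α + c₀ * (R + c₁ * Real.log (1 / α)) ^ d) :
    ∀ ε : ℝ, 0 < ε → ε ≤ ε₀ →
      H ε ≤ c₀ * (1 + Real.logb 2 (ε₀ / ε)) * (R + c₁ * Real.log (2 / ε)) ^ d := by
  have hP : ∀ ε a : ℝ, 0 < ε → 1 ≤ a → a ≤ 2 / ε →
      0 ≤ (R + c₁ * Real.log a) ^ d ∧
      (R + c₁ * Real.log a) ^ d ≤ (R + c₁ * Real.log (2 / ε)) ^ d := by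
    intro ε a hε ha hle
    have h1 : 0 ≤ Real.log a := Real.log_nonneg ha
    have h2 : Real.log a ≤ Real.log (2 / ε) := Real.log_le_log (by linarith) hle
    have h3 : 0 ≤ R + c₁ * Real.log a := by positivity
    refine ⟨pow_nonneg h3 d, pow_le_pow_left₀ h3 ?_ d⟩
    have := mul_le_mul_of_nonneg_left h2 hc₁.le
    linarith
  have key : ∀ n : ℕ, ∀ ε : ℝ, 0 < ε → ε ≤ ε₀ → ε₀ ≤ 2 ^ n * ε →
      H ε ≤ n * (c₀ * (R + c₁ * Real.log (2 / ε)) ^ d) := by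
    intro n
    induction n with
    | zero =>
      intro ε h0 h1 h2
      have : ε = ε₀ := le_antisymm h1 (by simpa using h2)
      subst this
      simpa using hinit
    | succ n ih =>
      intro ε h0 h1 h2
      push_cast
      rcases le_total (2 * ε) ε₀ with h | h
      · have a1 := ih (2 * ε) (by linarith) h (by rw [pow_succ] at h2; linarith)
        have a2 := hrec (2 * ε) (by linarith) h
        rw [show 2 * ε / 2 = ε by ring] at a2
        have a3 := (hP ε (2 / (2 * ε)) h0
          (by rw [le_div_iff₀ (by linarith)]; linarith)
          (by gcongr; linarith)).2
        have a4 := (hP ε (1 / (2 * ε)) h0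
          (by rw [le_div_iff₀ (by linarith)]; linarith)
          (by gcongr <;> linarith)).2
        have a5 := mul_le_mul_of_nonneg_left (mul_le_mul_of_nonneg_left a3 hc₀.le)
          (Nat.cast_nonneg (α := ℝ) n)
        have a6 := mul_le_mul_of_nonneg_left a4 hc₀.le
        linarith
      · have a1 := hmono (ε₀ / 2) ε (by linarith) (by linarith) h1
        have a2 := hrec ε₀ hε₀ le_rfl
        have a4 := hP ε (1 / ε₀) h0
          (by rw [le_div_iff₀ (by linarith)]; linarith)
          (by gcongr; linarith)
        have a6 := mul_le_mul_of_nonneg_left a4.2 hc₀.le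
        have a7 : 0 ≤ (n : ℝ) * (c₀ * (R + c₁ * Real.log (2 / ε)) ^ d) :=
          mul_nonneg (Nat.cast_nonneg n) (mul_nonneg hc₀.le (a4.1.trans a4.2))
        linarith
  intro ε h0 h1
  have hq : 1 ≤ ε₀ / ε := by rw [le_div_iff₀ h0]; linarith
  have hl : 0 ≤ Real.logb 2 (ε₀ / ε) := Real.logb_nonneg (by norm_num) hq
  have hc := Nat.le_ceil (Real.logb 2 (ε₀ / ε))
  have hc' := (Nat.ceil_lt_add_one hl).le
  have hk : ε₀ ≤ 2 ^ ⌈Real.logb 2 (ε₀ / ε)⌉₊ * ε := by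
    rw [← div_le_iff₀ h0]
    rw [Real.logb_le_iff_le_rpow (by norm_num) (by linarith), Real.rpow_natCast] at hc
    exact hc
  have a1 := key _ ε h0 h1 hk
  have a2 := hP ε (2 / ε) h0 (by rw [le_div_iff₀ h0]; linarith) le_rfl
  have a3 := mul_le_mul_of_nonneg_right hc' (mul_nonneg hc₀.le a2.1)
  linarith
end
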